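/- arXiv:1407.0539 — 7 statements merged into one kernel-verified Lean document; each statement's English description precedes it below -/
import Mathlib

section
/- Let {P₀, …, P_m} be a symmetric Clifford system on ℝ^{2l} and 0 ≤ i ≤ m−1. Then for each choice of sign ε = ±1, the set {x ∈ S^{2l−1} : ⟨P₀x, x⟩ = ⋯ = ⟨P_ix, x⟩ = 0 and ⟨P_{i+1}x, x⟩ = ε} equals {x ∈ S^{2l−1} : P_{i+1}x = εx}, i.e. the focal set 𝒰_ε of the isoparametric function f_i on M_i is the intersection of the ε-eigenspace of P_{i+1} with the unit sphere. -/
open Matrix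

theorem Matrix.IsSymm.mulVec_dotProduct_comm {n R : Type*} [Fintype n] [CommRing R]
    {A : Matrix n n R} (hA : A.IsSymm) (x y : n → R) :
    A.mulVec x ⬝ᵥ y = x ⬝ᵥ A.mulVec y := by
  rw [dotProduct_mulVec, ← mulVec_transpose, hA.eq]

/-- A symmetric involution attaining the value `ε = ±1` at a unit vector has it as eigenvector. -/
theorem Matrix.IsSymm.mulVec_eq_smul_of_dotProduct_eq {n : Type*} [Fintype n] [DecidableEq n]
    {A : Matrix n n ℝ} (hA : A.IsSymm) (hA2 : A * A = 1) {x : n → ℝ} (hx : x ⬝ᵥ x = 1)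
    {ε : ℝ} (hε : ε * ε = 1) (h : A.mulVec x ⬝ᵥ x = ε) : A.mulVec x = ε • x := by
  have hnorm : A.mulVec x ⬝ᵥ A.mulVec x = 1 := by
    rw [hA.mulVec_dotProduct_comm, mulVec_mulVec, hA2, one_mulVec, hx]
  rw [← sub_eq_zero, ← dotProduct_self_eq_zero]
  simp only [sub_dotProduct, dotProduct_sub, smul_dotProduct, dotProduct_smul, smul_eq_mul,
    hnorm, hx, h, dotProduct_comm x (A.mulVec x)]
  linarith

/-- If `A` anticommutes with a symmetric `B`, the quadratic form of `A` vanishes on eigenvectors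
of `B` with nonzero eigenvalue. -/
theorem Matrix.IsSymm.dotProduct_eq_zero_of_anticommute {n : Type*} [Fintype n]
    {A B : Matrix n n ℝ} (hB : B.IsSymm) (hAB : A * B + B * A = 0) {x : n → ℝ} {ε : ℝ}
    (hε : ε ≠ 0) (h : B.mulVec x = ε • x) : A.mulVec x ⬝ᵥ x = 0 := by
  have key : (A * B + B * A).mulVec x ⬝ᵥ x = 0 := by simp [hAB]
  rw [add_mulVec, ← mulVec_mulVec, ← mulVec_mulVec, add_dotProduct,
    hB.mulVec_dotProduct_comm, h, mulVec_smul, smul_dotProduct, dotProduct_smul,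
    smul_eq_mul] at key
  have : ε * (A.mulVec x ⬝ᵥ x) = 0 := by linarith
  exact (mul_eq_zero.mp this).resolve_left hε

/-- For a symmetric Clifford system `{P₀, …, P_m}` on `ℝ^{2l}` and `0 ≤ i ≤ m-1`,
for each sign `ε = ±1` the focal set
`{x ∈ S^{2l-1} : ⟨P₀x,x⟩ = ⋯ = ⟨P_ix,x⟩ = 0, ⟨P_{i+1}x,x⟩ = ε}` equals
`{x ∈ S^{2l-1} : P_{i+1} x = ε x}`. -/
theorem stmt_2 (l m i : ℕ) (hi : i + 1 ≤ m)
    (P : ℕ → Matrix (Fin (2 * l)) (Fin (2 * l)) ℝ)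
    (hs : ∀ α ≤ m, (P α).IsSymm)
    (hc : ∀ α ≤ m, ∀ β ≤ m,
      P α * P β + P β * P α = if α = β then (2 : ℝ) • 1 else 0)
    (ε : ℝ) (hε : ε = 1 ∨ ε = -1) :
    {x : Fin (2 * l) → ℝ | x ⬝ᵥ x = 1 ∧ (∀ α ≤ i, (P α).mulVec x ⬝ᵥ x = 0) ∧
        (P (i + 1)).mulVec x ⬝ᵥ x = ε}
    = {x : Fin (2 * l) → ℝ | x ⬝ᵥ x = 1 ∧ (P (i + 1)).mulVec x = ε • x} := by
  have hε2 : ε * ε = 1 := by rcases hε with rfl | rfl <;> norm_num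
  have hε0 : ε ≠ 0 := left_ne_zero_of_mul_eq_one hε2
  have hsq : P (i + 1) * P (i + 1) = 1 := by
    have h := hc (i + 1) hi (i + 1) hi
    rw [if_pos rfl, ← two_smul ℝ] at h
    exact smul_right_injective _ (two_ne_zero' ℝ) h
  ext x
  constructor
  · rintro ⟨hx, -, h⟩
    exact ⟨hx, (hs _ hi).mulVec_eq_smul_of_dotProduct_eq hsq hx hε2 h⟩
  · rintro ⟨hx, h⟩
    refine ⟨hx, fun α hα => ?_, ?_⟩
    · have hanti := hc α (by omega) (i + 1) hi
      rw [if_neg (by omega)] at hanti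
      exact (hs _ hi).dotProduct_eq_zero_of_anticommute hanti hε0 h
    · rw [h, smul_dotProduct, hx, smul_eq_mul, mul_one]
end

section
/- Let {P₀, …, P_m} be a symmetric Clifford system on ℝ^{2l}, 0 ≤ i ≤ m−1, and let x ∈ M_i, i.e. x ∈ S^{2l−1} with ⟨P₀x, x⟩ = ⋯ = ⟨P_ix, x⟩ = 0. Then the vector v := 2P_{i+1}x − 2⟨P_{i+1}x, x⟩x satisfies ⟨v, x⟩ = 0, ⟨v, P_αx⟩ = 0 for every 0 ≤ α ≤ i, and |v|² = 4(1 − ⟨P_{i+1}x, x⟩²). (This vector is the gradient of the isoparametric function f_i(x) = ⟨P_{i+1}x, x⟩ on M_i, and the identity expresses |∇f_i|² = 4(1 − f_i²).) -/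
open Matrix

/-- For symmetric matrices `A`, `B`, the inner product of `A x` and `B x` is half of the quadratic
form of the anticommutator `A * B + B * A` at `x`. -/
theorem two_mul_mulVec_dotProduct_mulVec {n : Type*} [Fintype n] {A B : Matrix n n ℝ}
    (hA : A.IsSymm) (hB : B.IsSymm) (x : n → ℝ) :
    2 * (A.mulVec x ⬝ᵥ B.mulVec x) = x ⬝ᵥ (A * B + B * A).mulVec x := by
  have key : ∀ {C D : Matrix n n ℝ}, C.IsSymm →
      x ⬝ᵥ (C * D).mulVec x = C.mulVec x ⬝ᵥ D.mulVec x := by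
    intro C D hC
    rw [← mulVec_mulVec, dotProduct_mulVec, ← mulVec_transpose, hC.eq]
  rw [add_mulVec, dotProduct_add, key hA, key hB, dotProduct_comm (B.mulVec x), two_mul]

/-- For a symmetric Clifford system `{P₀, …, P_m}` on `ℝ^{2l}`, `0 ≤ i ≤ m-1` and
`x ∈ M_i`, the vector `v = 2 P_{i+1}x - 2⟨P_{i+1}x, x⟩ x` (the gradient of the
isoparametric function `f_i` at `x`) is orthogonal to `x` and to each `P_α x`
(`0 ≤ α ≤ i`), and `|v|² = 4 (1 - ⟨P_{i+1}x, x⟩²)`. -/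
theorem stmt_4 (l m i : ℕ) (hi : i + 1 ≤ m)
    (P : ℕ → Matrix (Fin (2 * l)) (Fin (2 * l)) ℝ)
    (hs : ∀ α ≤ m, (P α).IsSymm)
    (hc : ∀ α ≤ m, ∀ β ≤ m,
      P α * P β + P β * P α = if α = β then (2 : ℝ) • 1 else 0)
    (x : Fin (2 * l) → ℝ) (hx : x ⬝ᵥ x = 1)
    (hxM : ∀ α ≤ i, (P α).mulVec x ⬝ᵥ x = 0)
    (v : Fin (2 * l) → ℝ)
    (hv : v = (2 : ℝ) • (P (i + 1)).mulVec x
        - (2 * ((P (i + 1)).mulVec x ⬝ᵥ x)) • x) :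
    v ⬝ᵥ x = 0 ∧ (∀ α ≤ i, v ⬝ᵥ (P α).mulVec x = 0) ∧
      v ⬝ᵥ v = 4 * (1 - ((P (i + 1)).mulVec x ⬝ᵥ x) ^ 2) := by
  have hQ := hs (i + 1) hi
  have hQQ : (P (i + 1)).mulVec x ⬝ᵥ (P (i + 1)).mulVec x = 1 := by
    have h := two_mul_mulVec_dotProduct_mulVec hQ hQ x
    rw [hc _ hi _ hi, if_pos rfl, smul_mulVec, one_mulVec, dotProduct_smul, hx, smul_eq_mul] at h
    linarith
  subst hv
  refine ⟨?_, fun α hα => ?_, ?_⟩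
  · simp only [sub_dotProduct, smul_dotProduct, smul_eq_mul, hx]
    ring
  · have hαm : α ≤ m := by omega
    have h := two_mul_mulVec_dotProduct_mulVec hQ (hs α hαm) x
    rw [hc _ hi _ hαm, if_neg (by omega), zero_mulVec, dotProduct_zero] at h
    simp only [sub_dotProduct, smul_dotProduct, smul_eq_mul, h,
      dotProduct_comm x ((P α).mulVec x), hxM α hα]
    ring
  · simp only [sub_dotProduct, smul_dotProduct, dotProduct_sub, dotProduct_smul, smul_eq_mul, hx,
      hQQ, dotProduct_comm x ((P (i + 1)).mulVec x)]
    ring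
end

section
/- Let {P₀, …, P_m} be a symmetric Clifford system on ℝ^{2l} and 0 ≤ i ≤ m−1. For x ∈ M_{i+1} and t ∈ ℝ define φ_t(x) := (cos t)·x + (sin t)·P_{i+1}x. Then φ_t(x) ∈ M_i, i.e. |φ_t(x)| = 1 and ⟨P_α φ_t(x), φ_t(x)⟩ = 0 for all 0 ≤ α ≤ i, and moreover ⟨P_{i+1} φ_t(x), φ_t(x)⟩ = sin 2t. (Thus the normal exponential map φ_t sends M_{i+1} into the level set 𝒰_{sin 2t} of f_i in M_i.) -/
open Matrix Real

/-- A symmetric matrix is self-adjoint for the dot product. -/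
theorem Matrix.IsSymm.mulVec_dotProduct {n R : Type*} [Fintype n] [CommSemiring R]
    {A : Matrix n n R} (hA : A.IsSymm) (u v : n → R) :
    A.mulVec u ⬝ᵥ v = u ⬝ᵥ A.mulVec v := by
  rw [dotProduct_mulVec, ← mulVec_transpose, hA.eq]

/-- For a symmetric Clifford system `{P₀, …, P_m}` on `ℝ^{2l}`, `0 ≤ i ≤ m-1` and
`x ∈ M_{i+1}`, the point `φ_t(x) = (cos t) x + (sin t) P_{i+1}x` lies in `M_i`,
and `⟨P_{i+1} φ_t(x), φ_t(x)⟩ = sin 2t`. -/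
theorem stmt_7 (l m i : ℕ) (hi : i + 1 ≤ m)
    (P : ℕ → Matrix (Fin (2 * l)) (Fin (2 * l)) ℝ)
    (hs : ∀ α ≤ m, (P α).IsSymm)
    (hc : ∀ α ≤ m, ∀ β ≤ m,
      P α * P β + P β * P α = if α = β then (2 : ℝ) • 1 else 0)
    (x : Fin (2 * l) → ℝ) (hx : x ⬝ᵥ x = 1)
    (hxM : ∀ α ≤ i + 1, (P α).mulVec x ⬝ᵥ x = 0)
    (t : ℝ) (y : Fin (2 * l) → ℝ)
    (hy : y = Real.cos t • x + Real.sin t • (P (i + 1)).mulVec x) :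
    y ⬝ᵥ y = 1 ∧ (∀ α ≤ i, (P α).mulVec y ⬝ᵥ y = 0) ∧
      (P (i + 1)).mulVec y ⬝ᵥ y = Real.sin (2 * t) := by
  have hQs : (P (i + 1)).IsSymm := hs _ hi
  have hQQ : P (i + 1) * P (i + 1) = 1 := by
    have h := hc (i + 1) hi (i + 1) hi
    rw [if_pos rfl, ← two_smul ℝ] at h
    exact smul_right_injective _ (two_ne_zero' ℝ) h
  have hQ0 := hxM (i + 1) le_rfl
  have hQanti : ∀ α ≤ i, P α * P (i + 1) = -(P (i + 1) * P α) := fun α hα => by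
    have h := hc α (by omega) (i + 1) hi
    rw [if_neg (by omega)] at h
    exact eq_neg_of_add_eq_zero_left h
  generalize P (i + 1) = Q at *
  have hQQv : ∀ v, Q.mulVec (Q.mulVec v) = v := fun v => by
    rw [mulVec_mulVec, hQQ, one_mulVec]
  have hQ0' : x ⬝ᵥ Q.mulVec x = 0 := by rw [dotProduct_comm, hQ0]
  have hQ1 : Q.mulVec x ⬝ᵥ Q.mulVec x = 1 := by
    rw [hQs.mulVec_dotProduct, hQQv, hx]
  have hcs := Real.sin_sq_add_cos_sq t
  subst hy
  refine ⟨?_, fun α hα => ?_, ?_⟩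
  · simp only [add_dotProduct, dotProduct_add, smul_dotProduct, dotProduct_smul, smul_eq_mul,
      hx, hQ0, hQ0', hQ1]
    linear_combination hcs
  · have h0 := hxM α (by omega)
    have hanti : (P α).mulVec (Q.mulVec x) = -Q.mulVec ((P α).mulVec x) := by
      rw [mulVec_mulVec, hQanti α hα, neg_mulVec, mulVec_mulVec]
    simp only [mulVec_add, mulVec_smul, add_dotProduct, dotProduct_add, smul_dotProduct,
      dotProduct_smul, smul_eq_mul, hanti, neg_dotProduct, hQs.mulVec_dotProduct, hQQv, h0]
    ring
  · simp only [mulVec_add, mulVec_smul, hQQv, add_dotProduct, dotProduct_add, smul_dotProduct,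
      dotProduct_smul, smul_eq_mul, hx, hQ0, hQ0', hQ1, Real.sin_two_mul]
    ring
end

section
/- Let {P₀, …, P_m} be a symmetric Clifford system on ℝ^{2l}, 2 ≤ i ≤ m, and let y ∈ S^{2l−1} satisfy P_iy = y and ⟨P_αy, y⟩ = 0 for all 0 ≤ α ≤ i−1. Let z, v be unit vectors in the linear span of {P₀y, …, P_{i−1}y} with ⟨z, v⟩ = 0. Then the curve c(t) := (y + (cos t)z + (sin t)v)/√2 lies in N_{i−1} for every t ∈ ℝ, and its second derivative satisfies c''(t) = ½(P_ic(t) − c(t)). (Hence the fibers of the focal map ψ_{π/4} are totally geodesic in N_{i−1}.) -/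
open Matrix Real

section CliffordSystem

variable {n : Type*} [Fintype n]

theorem mulVec_dotProduct_comm_of_isSymm {A : Matrix n n ℝ} (hA : A.IsSymm) (x y : n → ℝ) :
    A *ᵥ x ⬝ᵥ y = x ⬝ᵥ A *ᵥ y := by
  rw [Matrix.dotProduct_mulVec, ← Matrix.mulVec_transpose, hA.eq]

theorem mulVec_mulVec_of_anticommute {R A : Matrix n n ℝ} (h : R * A + A * R = 0)
    (x : n → ℝ) : R *ᵥ A *ᵥ x = -(A *ᵥ R *ᵥ x) := by
  rw [Matrix.mulVec_mulVec, Matrix.mulVec_mulVec, ← Matrix.neg_mulVec,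
    eq_neg_of_add_eq_zero_left h]

/-- A symmetric matrix anticommuting with `R` has vanishing quadratic form on the `-1`-eigenspace
of `R`. -/
theorem mulVec_dotProduct_self_eq_zero_of_anticommute {R A : Matrix n n ℝ} (hR : R.IsSymm)
    (h : R * A + A * R = 0) {w : n → ℝ} (hw : R *ᵥ w = -w) : A *ᵥ w ⬝ᵥ w = 0 := by
  have h1 : R *ᵥ A *ᵥ w = A *ᵥ w := by
    rw [mulVec_mulVec_of_anticommute h, hw, Matrix.mulVec_neg, neg_neg]
  have h2 := mulVec_dotProduct_comm_of_isSymm hR (A *ᵥ w) w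
  rw [h1, hw, dotProduct_neg] at h2
  linarith

variable [DecidableEq n]

/-- The vectors `P α *ᵥ y` of a symmetric Clifford system at a unit vector are orthonormal. -/
theorem mulVec_dotProduct_mulVec_of_clifford {A B : Matrix n n ℝ} (hA : A.IsSymm)
    (hB : B.IsSymm) {r : ℝ} (h : A * B + B * A = r • (1 : Matrix n n ℝ)) (y : n → ℝ) :
    2 * (A *ᵥ y ⬝ᵥ B *ᵥ y) = r * (y ⬝ᵥ y) := by
  have h1 : A *ᵥ y ⬝ᵥ B *ᵥ y = y ⬝ᵥ (A * B) *ᵥ y := by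
    rw [mulVec_dotProduct_comm_of_isSymm hA, Matrix.mulVec_mulVec]
  have h2 : A *ᵥ y ⬝ᵥ B *ᵥ y = y ⬝ᵥ (B * A) *ᵥ y := by
    rw [dotProduct_comm, mulVec_dotProduct_comm_of_isSymm hB, Matrix.mulVec_mulVec]
  have h3 := congrArg (fun M => y ⬝ᵥ M *ᵥ y) h
  simp only [Matrix.add_mulVec, dotProduct_add, Matrix.smul_mulVec, Matrix.one_mulVec,
    dotProduct_smul, smul_eq_mul] at h3
  linarith

end CliffordSystem

theorem deriv_deriv_smul_cos_add_sin {E : Type*} [NormedAddCommGroup E] [NormedSpace ℝ E]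
    (r : ℝ) (y z v : E) (t : ℝ) :
    deriv (deriv fun t : ℝ => r • (y + Real.cos t • z + Real.sin t • v)) t =
      -(r • (Real.cos t • z + Real.sin t • v)) := by
  have h1 : (deriv fun t : ℝ => r • (y + Real.cos t • z + Real.sin t • v)) =
      fun t => r • (-Real.sin t • z + Real.cos t • v) := by
    funext s
    exact ((((Real.hasDerivAt_cos s).smul_const z).const_add y).add
      ((Real.hasDerivAt_sin s).smul_const v)).const_smul r |>.deriv
  rw [h1]
  have h2 := ((((Real.hasDerivAt_sin t).neg.smul_const z).add
    ((Real.hasDerivAt_cos t).smul_const v)).const_smul r).deriv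
  refine h2.trans ?_
  module

/-- For a symmetric Clifford system `{P₀, …, P_m}` on `ℝ^{2l}`, `2 ≤ i ≤ m`,
`y ∈ S^{2l-1}` with `P_iy = y`, `⟨P_αy, y⟩ = 0` (`0 ≤ α ≤ i-1`), and orthonormal
`z, v` in the span of `{P₀y, …, P_{i-1}y}`: the curve
`c(t) = (y + (cos t) z + (sin t) v)/√2` lies in `N_{i-1}`, and
`c''(t) = ½ (P_i c(t) - c(t))`. -/
theorem stmt_13 (l m i : ℕ) (hi2 : 2 ≤ i) (him : i ≤ m)
    (P : ℕ → Matrix (Fin (2 * l)) (Fin (2 * l)) ℝ)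
    (hs : ∀ α ≤ m, (P α).IsSymm)
    (hc : ∀ α ≤ m, ∀ β ≤ m,
      P α * P β + P β * P α = if α = β then (2 : ℝ) • 1 else 0)
    (y z v : Fin (2 * l) → ℝ)
    (hy : y ⬝ᵥ y = 1) (hy1 : (P i).mulVec y = y)
    (hy0 : ∀ α ≤ i - 1, (P α).mulVec y ⬝ᵥ y = 0)
    (hz : z ⬝ᵥ z = 1) (hv : v ⬝ᵥ v = 1) (hzv : z ⬝ᵥ v = 0)
    (hzspan : z ∈ Submodule.span ℝ ((fun α => (P α).mulVec y) '' {α | α ≤ i - 1}))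
    (hvspan : v ∈ Submodule.span ℝ ((fun α => (P α).mulVec y) '' {α | α ≤ i - 1}))
    (c : ℝ → (Fin (2 * l) → ℝ))
    (hcurve : c = fun t => (Real.sqrt 2)⁻¹ • (y + Real.cos t • z + Real.sin t • v)) :
    ∀ t : ℝ,
      (c t ⬝ᵥ c t = 1 ∧
        ∑ α ∈ Finset.range i, ((P α).mulVec (c t) ⬝ᵥ c t) ^ 2 = 1) ∧
      deriv (deriv c) t = (2 : ℝ)⁻¹ • ((P i).mulVec (c t) - c t) := by
  have anti : ∀ α ∈ Finset.range i, P i * P α + P α * P i = 0 := fun α hα => by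
    have hα := Finset.mem_range.mp hα
    rw [hc i him α (by omega), if_neg (by omega)]
  have ortho : ∀ α ∈ Finset.range i, ∀ β ∈ Finset.range i,
      P α *ᵥ y ⬝ᵥ P β *ᵥ y = if α = β then 1 else 0 := fun α hα β hβ => by
    have hα := Finset.mem_range.mp hα
    have hβ := Finset.mem_range.mp hβ
    have h := mulVec_dotProduct_mulVec_of_clifford (hs α (by omega)) (hs β (by omega))
      (r := if α = β then 2 else 0)
      (by rw [hc α (by omega) β (by omega)]; split_ifs <;> simp) y
    rw [hy] at h
    split_ifs at h ⊢ <;> linarith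
  have him1 : {α | α ≤ i - 1} = (Finset.range i : Set ℕ) := by
    ext α
    simp only [Set.mem_ofPred_eq, Finset.coe_range, Set.mem_Iio]
    omega
  intro t
  set w : Fin (2 * l) → ℝ := Real.cos t • z + Real.sin t • v with hw
  have hwspan := Submodule.add_mem _ (Submodule.smul_mem _ (Real.cos t) hzspan)
    (Submodule.smul_mem _ (Real.sin t) hvspan)
  rw [him1, ← hw, Submodule.mem_span_image_finset_iff_exists_fun'] at hwspan
  obtain ⟨a, ha⟩ := hwspan
  have hww : w ⬝ᵥ w = 1 := by
    have hvz : v ⬝ᵥ z = 0 := by rw [dotProduct_comm, hzv]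
    simp only [hw, add_dotProduct, dotProduct_add, smul_dotProduct, dotProduct_smul,
      smul_eq_mul, hz, hv, hzv, hvz]
    linear_combination Real.cos_sq_add_sin_sq t
  have hPyw : ∀ α ∈ Finset.range i, P α *ᵥ y ⬝ᵥ w = a α := fun α hα => by
    rw [← ha, dotProduct_sum, Finset.sum_eq_single_of_mem α hα]
    · simp [ortho α hα α hα]
    · intro β hβ hne
      simp [ortho α hα β hβ, hne.symm]
  have hsum : ∑ α ∈ Finset.range i, a α ^ 2 = 1 := by
    rw [← hww]
    nth_rewrite 1 [← ha]
    rw [sum_dotProduct]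
    refine Finset.sum_congr rfl fun α hα => ?_
    rw [smul_dotProduct, hPyw α hα, smul_eq_mul, sq]
  have hyw : y ⬝ᵥ w = 0 := by
    rw [← ha, dotProduct_sum]
    refine Finset.sum_eq_zero fun α hα => ?_
    have hα := Finset.mem_range.mp hα
    rw [dotProduct_smul, dotProduct_comm, hy0 α (by omega), smul_zero]
  have hPiw : P i *ᵥ w = -w := by
    rw [← ha, Matrix.mulVec_sum, ← Finset.sum_neg_distrib]
    refine Finset.sum_congr rfl fun α hα => ?_
    rw [Matrix.mulVec_smul, mulVec_mulVec_of_anticommute (anti α hα), hy1, smul_neg]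
  have hct : c t = (Real.sqrt 2)⁻¹ • (y + w) := by rw [hcurve, hw, ← add_assoc]
  have hsq : (Real.sqrt 2)⁻¹ * (Real.sqrt 2)⁻¹ = 1 / 2 := by
    rw [← mul_inv, Real.mul_self_sqrt (by norm_num), one_div]
  refine ⟨⟨?_, ?_⟩, ?_⟩
  · have hwy : w ⬝ᵥ y = 0 := by rw [dotProduct_comm, hyw]
    simp only [hct, add_dotProduct, dotProduct_add, smul_dotProduct, dotProduct_smul,
      smul_eq_mul, hy, hww, hyw, hwy]
    linear_combination 2 * hsq
  · rw [← hsum]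
    refine Finset.sum_congr rfl fun α hα => ?_
    have hα' := Finset.mem_range.mp hα
    have hwy : P α *ᵥ w ⬝ᵥ y = a α := by
      rw [mulVec_dotProduct_comm_of_isSymm (hs α (by omega)), dotProduct_comm, hPyw α hα]
    congr 1
    simp only [hct, Matrix.mulVec_smul, Matrix.mulVec_add, add_dotProduct, dotProduct_add,
      smul_dotProduct, dotProduct_smul, smul_eq_mul, hPyw α hα, hwy, hy0 α (by omega),
      mulVec_dotProduct_self_eq_zero_of_anticommute (hs i him) (anti α hα) hPiw]
    linear_combination 2 * a α * hsq
  · have hd := deriv_deriv_smul_cos_add_sin (Real.sqrt 2)⁻¹ y z v t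
    rw [← hcurve, ← hw] at hd
    rw [hd, hct, Matrix.mulVec_smul, Matrix.mulVec_add, hy1, hPiw]
    module
end

section
/- Let {P₀, …, P_m} be a symmetric Clifford system on ℝ^{2l}, 0 ≤ i ≤ m−1, c ∈ (−1, 1), and let x ∈ S^{2l−1} satisfy ⟨P_αx, x⟩ = 0 for 0 ≤ α ≤ i and ⟨P_{i+1}x, x⟩ = c. Set ξ := (P_{i+1}x − cx)/√(1−c²). Then for every Q in the linear span of {P₀, …, P_i}: (a) Qξ is orthogonal to x, to ξ, and to P_αx for every 0 ≤ α ≤ i; and (b) P_{i+1}(Qξ) = c·Qξ − √(1−c²)·Qx. (Since Qx is normal to 𝒰_c, this shows Qξ is a principal direction with principal curvature 0.) -/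
open Matrix Real

namespace Matrix

variable {n : Type*} [Fintype n] {A B Q : Matrix n n ℝ}

/-- A symmetric matrix is self-adjoint for the dot product. -/
theorem IsSymm.mulVec_dotProduct_s15 (hA : A.IsSymm) (v w : n → ℝ) :
    A *ᵥ v ⬝ᵥ w = v ⬝ᵥ A *ᵥ w := by
  rw [dotProduct_mulVec, ← mulVec_transpose, hA.eq]

variable [DecidableEq n]

/-- If symmetric `A` and `B` have anticommutator the scalar `2 * t`, then the quadratic form of
`A * B` is `t` times the squared norm. -/
theorem mulVec_dotProduct_mulVec_of_anticomm_eq_smul_one (hA : A.IsSymm) (hB : B.IsSymm) {t : ℝ}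
    (h : A * B + B * A = (2 * t) • 1) (x : n → ℝ) : A *ᵥ x ⬝ᵥ B *ᵥ x = t * (x ⬝ᵥ x) := by
  have h1 : (A * B + B * A) *ᵥ x ⬝ᵥ x = 2 * t * (x ⬝ᵥ x) := by
    simp [h, smul_mulVec, smul_dotProduct]
  rw [add_mulVec, add_dotProduct, ← mulVec_mulVec, ← mulVec_mulVec, hA.mulVec_dotProduct_s15 (B *ᵥ x),
    hB.mulVec_dotProduct_s15 (A *ᵥ x), dotProduct_comm (B *ᵥ x)] at h1
  linarith

/-- If symmetric `Q` and `B` both anticommute with `A` and `Q * B + B * Q` is the scalar `2 * t`,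
then the quadratic form of `B * Q * A` is `t` times that of `A`. -/
theorem mulVec_mulVec_dotProduct_mulVec (hA : A.IsSymm) (hB : B.IsSymm) (hQ : Q.IsSymm) {t : ℝ}
    (hQA : Q * A + A * Q = 0) (hBA : B * A + A * B = 0) (hQB : Q * B + B * Q = (2 * t) • 1)
    (x : n → ℝ) : Q *ᵥ A *ᵥ x ⬝ᵥ B *ᵥ x = t * (A *ᵥ x ⬝ᵥ x) := by
  have h1 : B * Q * A + A * Q * B = (2 * t) • A := by
    rw [← one_mul A, ← smul_mul_assoc, ← hQB]
    linear_combination (norm := noncomm_ring) hQA * B - Q * hBA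
  have h2 : (B * Q * A + A * Q * B) *ᵥ x ⬝ᵥ x = 2 * t * (A *ᵥ x ⬝ᵥ x) := by
    rw [h1, smul_mulVec, smul_dotProduct, smul_eq_mul]
  simp only [add_mulVec, add_dotProduct, ← mulVec_mulVec, hA.mulVec_dotProduct_s15,
    hB.mulVec_dotProduct_s15, hQ.mulVec_dotProduct_s15] at h2 ⊢
  have h3 : x ⬝ᵥ B *ᵥ Q *ᵥ A *ᵥ x = x ⬝ᵥ A *ᵥ Q *ᵥ B *ᵥ x := by
    rw [← hB.mulVec_dotProduct_s15, ← hQ.mulVec_dotProduct_s15, ← hA.mulVec_dotProduct_s15, dotProduct_comm]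
  linarith

end Matrix

/-- For a symmetric Clifford system `{P₀, …, P_m}` on `ℝ^{2l}`, `0 ≤ i ≤ m-1`,
`c ∈ (-1,1)`, `x ∈ 𝒰_c` and `ξ = (P_{i+1}x - cx)/√(1-c²)`: for every
`Q ∈ span{P₀, …, P_i}`, (a) `Qξ` is orthogonal to `x`, to `ξ` and to each
`P_αx` (`0 ≤ α ≤ i`), and (b) `P_{i+1}(Qξ) = c Qξ - √(1-c²) Qx`. -/
theorem stmt_15 (l m i : ℕ) (hi : i + 1 ≤ m)
    (P : ℕ → Matrix (Fin (2 * l)) (Fin (2 * l)) ℝ)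
    (hs : ∀ α ≤ m, (P α).IsSymm)
    (hc : ∀ α ≤ m, ∀ β ≤ m,
      P α * P β + P β * P α = if α = β then (2 : ℝ) • 1 else 0)
    (c : ℝ) (hc1 : -1 < c) (hc2 : c < 1)
    (x : Fin (2 * l) → ℝ) (hx : x ⬝ᵥ x = 1)
    (hx0 : ∀ α ≤ i, (P α).mulVec x ⬝ᵥ x = 0)
    (hxc : (P (i + 1)).mulVec x ⬝ᵥ x = c)
    (ξ : Fin (2 * l) → ℝ)
    (hξ : ξ = (Real.sqrt (1 - c ^ 2))⁻¹ • ((P (i + 1)).mulVec x - c • x)) :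
    ∀ Q : Matrix (Fin (2 * l)) (Fin (2 * l)) ℝ,
      Q ∈ Submodule.span ℝ (P '' {α | α ≤ i}) →
      (Q.mulVec ξ ⬝ᵥ x = 0 ∧ Q.mulVec ξ ⬝ᵥ ξ = 0 ∧
        (∀ α ≤ i, Q.mulVec ξ ⬝ᵥ (P α).mulVec x = 0)) ∧
      (P (i + 1)).mulVec (Q.mulVec ξ)
        = c • Q.mulVec ξ - Real.sqrt (1 - c ^ 2) • Q.mulVec x := by
  intro Q hQ
  set A := P (i + 1)
  have hA : A.IsSymm := hs _ hi
  have hAA : A * A = 1 := by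
    have h := hc _ hi _ hi
    rw [if_pos rfl, ← two_smul ℝ (P (i + 1) * P (i + 1))] at h
    exact smul_right_injective _ (two_ne_zero (α := ℝ)) h
  have hPA : ∀ α ≤ i, P α * A + A * P α = 0 := fun α hα => by
    rw [hc α (by omega) _ hi, if_neg (by omega)]
  obtain ⟨hQs, hQA, hQx, hQP⟩ : Q.IsSymm ∧ Q * A + A * Q = 0 ∧ Q *ᵥ x ⬝ᵥ x = 0 ∧
      ∀ α ≤ i, ∃ t : ℝ, Q * P α + P α * Q = (2 * t) • 1 := by
    induction hQ using Submodule.span_induction with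
    | mem R hR =>
      obtain ⟨β, hβ : β ≤ i, rfl⟩ := hR
      refine ⟨hs β (by omega), hPA β hβ, hx0 β hβ, fun α hα =>
        ⟨if β = α then 1 else 0, ?_⟩⟩
      rw [hc β (by omega) α (by omega)]
      split_ifs <;> simp
    | zero => exact ⟨isSymm_zero, by simp, by simp, fun α _ => ⟨0, by simp⟩⟩
    | add R S _ _ hR hS =>
      obtain ⟨hR1, hR2, hR3, hR4⟩ := hR
      obtain ⟨hS1, hS2, hS3, hS4⟩ := hS
      refine ⟨hR1.add hS1, ?_, by rw [add_mulVec, add_dotProduct, hR3, hS3, add_zero],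
        fun α hα => ?_⟩
      · rw [add_mul, mul_add, add_add_add_comm, hR2, hS2, add_zero]
      · obtain ⟨t, ht⟩ := hR4 α hα
        obtain ⟨u, hu⟩ := hS4 α hα
        exact ⟨t + u, by rw [add_mul, mul_add, add_add_add_comm, ht, hu, mul_add, add_smul]⟩
    | smul a R _ hR =>
      obtain ⟨hR1, hR2, hR3, hR4⟩ := hR
      refine ⟨hR1.smul a, ?_, by rw [smul_mulVec, smul_dotProduct, hR3, smul_zero],
        fun α hα => ?_⟩
      · rw [smul_mul_assoc, mul_smul_comm, ← smul_add, hR2, smul_zero]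
      · obtain ⟨t, ht⟩ := hR4 α hα
        exact ⟨a * t, by
          rw [smul_mul_assoc, mul_smul_comm, ← smul_add, ht, smul_smul, mul_left_comm]⟩
  have hpos : 0 < 1 - c ^ 2 := by nlinarith
  have hsqrt : √(1 - c ^ 2) ≠ 0 := (Real.sqrt_pos.2 hpos).ne'
  have hsq : √(1 - c ^ 2) ^ 2 = 1 - c ^ 2 := Real.sq_sqrt hpos.le
  have hQξ : Q *ᵥ ξ = (√(1 - c ^ 2))⁻¹ • (Q *ᵥ A *ᵥ x - c • Q *ᵥ x) := by
    rw [hξ, mulVec_smul, mulVec_sub, mulVec_smul]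
  have hQxAx : Q *ᵥ x ⬝ᵥ A *ᵥ x = 0 := by
    rw [mulVec_dotProduct_mulVec_of_anticomm_eq_smul_one (t := 0) hQs hA (by simpa using hQA),
      zero_mul]
  have hQAx : Q *ᵥ A *ᵥ x ⬝ᵥ x = 0 := by
    rw [hQs.mulVec_dotProduct_s15, dotProduct_comm, hQxAx]
  have hAQA : A *ᵥ Q *ᵥ A *ᵥ x = -(Q *ᵥ x) := by
    have h : A * Q * A = -Q := by
      rw [eq_neg_of_add_eq_zero_right hQA, neg_mul, mul_assoc, hAA, mul_one]
    rw [mulVec_mulVec, mulVec_mulVec, h, neg_mulVec]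
  have hAQ : A *ᵥ Q *ᵥ x = -(Q *ᵥ A *ᵥ x) := by
    rw [mulVec_mulVec, mulVec_mulVec, eq_neg_of_add_eq_zero_right hQA, neg_mulVec]
  have hQAxAx : Q *ᵥ A *ᵥ x ⬝ᵥ A *ᵥ x = 0 := by
    rw [← hA.mulVec_dotProduct_s15, hAQA, neg_dotProduct, hQx, neg_zero]
  refine ⟨⟨?_, ?_, fun α hα => ?_⟩, ?_⟩
  · simp [-mulVec_mulVec, hQξ, smul_dotProduct, sub_dotProduct, hQx, hQAx]
  · rw [hQξ, hξ]
    simp [-mulVec_mulVec, smul_dotProduct, dotProduct_smul, sub_dotProduct, dotProduct_sub, hQx,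
      hQAx, hQxAx, hQAxAx]
  · obtain ⟨t, ht⟩ := hQP α hα
    have hP : (P α).IsSymm := hs α (by omega)
    rw [hQξ, smul_dotProduct, sub_dotProduct, smul_dotProduct,
      mulVec_mulVec_dotProduct_mulVec hA hP hQs hQA (hPA α hα) ht,
      mulVec_dotProduct_mulVec_of_anticomm_eq_smul_one hQs hP ht, hx, hxc]
    simp [mul_comm]
  · rw [hQξ, mulVec_smul, mulVec_sub, mulVec_smul, hAQA, hAQ]
    ext j
    simp only [Pi.smul_apply, Pi.sub_apply, Pi.neg_apply, smul_eq_mul]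
    field_simp
    rw [hsq]
    ring
end

section
/- Let {P₀, …, P_m} be a symmetric Clifford system on ℝ^{2l}, 2 ≤ i ≤ m, c ∈ (−1, 1), and let x ∈ S^{2l−1} satisfy Σ_{α=0}^{i} ⟨P_αx, x⟩² = 1 and ⟨P_ix, x⟩ = c. Write a_α := ⟨P_αx, x⟩ and 𝒫 := Σ_{α=0}^{i} a_α P_α. Suppose X ∈ ℝ^{2l} satisfies 𝒫X = X and ⟨X, P_iRx⟩ = 0 for every R = Σ_{α=0}^{i} b_α P_α with Σ_{α=0}^{i} a_α b_α = 0. Then ⟨X, P_ix⟩ = c⟨X, x⟩ and ⟨X, x⟩ = 0 (hence also ⟨X, P_ix⟩ = 0). -/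
open Matrix

/-- A Clifford combination anticommutes with a generator up to twice its coefficient. -/
theorem clifford_anticomm_sum {n : Type*} [Fintype n] [DecidableEq n] (m i : ℕ) (him : i ≤ m)
    (P : ℕ → Matrix n n ℝ)
    (hcl : ∀ α ≤ m, ∀ β ≤ m,
      P α * P β + P β * P α = if α = β then (2 : ℝ) • 1 else 0)
    (a : ℕ → ℝ) (α : ℕ) (hα : α ∈ Finset.range (i + 1)) :
    P α * (∑ β ∈ Finset.range (i + 1), a β • P β)
      + (∑ β ∈ Finset.range (i + 1), a β • P β) * P α = (2 * a α) • 1 := by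
  rw [Finset.mul_sum, Finset.sum_mul, ← Finset.sum_add_distrib, Finset.sum_eq_single_of_mem α hα]
  · rw [mul_smul_comm, smul_mul_assoc, ← smul_add,
      hcl α (by grind) α (by grind), if_pos rfl, smul_smul, mul_comm]
  · intro β hβ hne
    rw [mul_smul_comm, smul_mul_assoc, ← smul_add,
      hcl α (by grind) β (by grind), if_neg hne.symm, smul_zero]

/-- A Clifford combination with unit coefficient vector is an involution. -/
theorem clifford_sum_mul_self {n : Type*} [Fintype n] [DecidableEq n] (m i : ℕ) (him : i ≤ m)
    (P : ℕ → Matrix n n ℝ)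
    (hcl : ∀ α ≤ m, ∀ β ≤ m,
      P α * P β + P β * P α = if α = β then (2 : ℝ) • 1 else 0)
    (a : ℕ → ℝ) (ha : ∑ α ∈ Finset.range (i + 1), a α ^ 2 = 1) :
    (∑ β ∈ Finset.range (i + 1), a β • P β) * (∑ β ∈ Finset.range (i + 1), a β • P β) = 1 := by
  set Q := ∑ β ∈ Finset.range (i + 1), a β • P β with hQ
  have h : Q * Q + Q * Q = (2 : ℝ) • 1 := by
    calc Q * Q + Q * Q = ∑ α ∈ Finset.range (i + 1), a α • (P α * Q + Q * P α) := by
          nth_rewrite 1 [hQ]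
          nth_rewrite 3 [hQ]
          simp only [smul_add, Finset.sum_add_distrib, Finset.sum_mul, Finset.mul_sum,
            smul_mul_assoc, mul_smul_comm]
      _ = ∑ α ∈ Finset.range (i + 1), (2 * a α ^ 2) • (1 : Matrix n n ℝ) := by
          refine Finset.sum_congr rfl fun α hα => ?_
          rw [clifford_anticomm_sum m i him P hcl a α hα, smul_smul]
          congr 1
          ring
      _ = (2 : ℝ) • 1 := by rw [← Finset.sum_smul, ← Finset.mul_sum, ha, mul_one]
  rw [← two_smul ℝ] at h
  exact smul_right_injective _ (two_ne_zero' ℝ) h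

/-- A symmetric involution fixes every unit vector on which its quadratic form equals one. -/
theorem mulVec_eq_self_of_dotProduct_eq_one {n : Type*} [Fintype n] [DecidableEq n]
    (Q : Matrix n n ℝ) (hs : Q.IsSymm) (hQ : Q * Q = 1) (x : n → ℝ) (hx : x ⬝ᵥ x = 1)
    (h : Q.mulVec x ⬝ᵥ x = 1) : Q.mulVec x = x := by
  have h2 : Q.mulVec x ⬝ᵥ Q.mulVec x = 1 := by
    rw [dotProduct_mulVec, ← mulVec_transpose, hs.eq, mulVec_mulVec, hQ, one_mulVec, hx]
  rw [← sub_eq_zero, ← dotProduct_self_eq_zero]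
  simp only [sub_dotProduct, dotProduct_sub]
  rw [h2, h, hx, dotProduct_comm x, h]
  norm_num

/-- For a symmetric Clifford system `{P₀, …, P_m}` on `ℝ^{2l}`, `2 ≤ i ≤ m`,
`c ∈ (-1,1)`, `x ∈ 𝒱_c` with `a_α = ⟨P_αx, x⟩` and `𝒫 = ∑ a_α P_α`: if
`𝒫X = X` and `⟨X, P_i R x⟩ = 0` for every `R = ∑ b_α P_α` with `∑ a_α b_α = 0`,
then `⟨X, P_ix⟩ = c⟨X, x⟩` and `⟨X, x⟩ = 0` (hence `⟨X, P_ix⟩ = 0`). -/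
theorem stmt_16 (l m i : ℕ) (hi2 : 2 ≤ i) (him : i ≤ m)
    (P : ℕ → Matrix (Fin (2 * l)) (Fin (2 * l)) ℝ)
    (hs : ∀ α ≤ m, (P α).IsSymm)
    (hcl : ∀ α ≤ m, ∀ β ≤ m,
      P α * P β + P β * P α = if α = β then (2 : ℝ) • 1 else 0)
    (c : ℝ) (hc1 : -1 < c) (hc2 : c < 1)
    (x : Fin (2 * l) → ℝ) (hx : x ⬝ᵥ x = 1)
    (a : ℕ → ℝ) (ha : ∀ α, a α = (P α).mulVec x ⬝ᵥ x)
    (hxN : ∑ α ∈ Finset.range (i + 1), (a α) ^ 2 = 1)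
    (hxc : a i = c)
    (Pcal : Matrix (Fin (2 * l)) (Fin (2 * l)) ℝ)
    (hPcal : Pcal = ∑ α ∈ Finset.range (i + 1), a α • P α)
    (X : Fin (2 * l) → ℝ)
    (hX1 : Pcal.mulVec X = X)
    (hX2 : ∀ b : ℕ → ℝ, (∑ α ∈ Finset.range (i + 1), a α * b α) = 0 →
      X ⬝ᵥ (P i).mulVec ((∑ α ∈ Finset.range (i + 1), b α • P α).mulVec x) = 0) :
    X ⬝ᵥ (P i).mulVec x = c * (X ⬝ᵥ x) ∧ X ⬝ᵥ x = 0 ∧ X ⬝ᵥ (P i).mulVec x = 0 := by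
  have hi : i ∈ Finset.range (i + 1) := Finset.self_mem_range_succ i
  have hsymm : Pcal.IsSymm := by
    rw [Matrix.IsSymm, hPcal, transpose_sum]
    refine Finset.sum_congr rfl fun α hα => ?_
    rw [transpose_smul, (hs α (by grind)).eq]
  have hfix : Pcal.mulVec x = x := by
    refine mulVec_eq_self_of_dotProduct_eq_one Pcal hsymm
      (hPcal ▸ clifford_sum_mul_self m i him P hcl a hxN) x hx ?_
    rw [hPcal, sum_mulVec, sum_dotProduct, ← hxN]
    refine Finset.sum_congr rfl fun α _ => ?_
    rw [smul_mulVec, smul_dotProduct, ← ha, smul_eq_mul, sq]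
  have hanti : P i * Pcal + Pcal * P i = (2 * c) • 1 := by
    rw [hPcal, clifford_anticomm_sum m i him P hcl a i hi, hxc]
  have hsq : P i * P i = 1 := by
    have h := hcl i him i him
    rw [if_pos rfl, ← two_smul ℝ] at h
    exact smul_right_injective _ (two_ne_zero' ℝ) h
  have hkey : X ⬝ᵥ (P i).mulVec x = c * (X ⬝ᵥ x) := by
    have h1 : X ⬝ᵥ (Pcal * P i).mulVec x = X ⬝ᵥ (P i).mulVec x := by
      rw [← mulVec_mulVec, dotProduct_mulVec, ← mulVec_transpose, hsymm.eq, hX1]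
    have h2 := congrArg (fun M => X ⬝ᵥ M.mulVec x) hanti
    simp only [add_mulVec, dotProduct_add, smul_mulVec, one_mulVec, dotProduct_smul,
      smul_eq_mul] at h2
    rw [h1, ← mulVec_mulVec, hfix] at h2
    linarith
  have hzero : X ⬝ᵥ x = 0 := by
    have h := hX2 (fun α => (if α = i then 1 else 0) - c * a α) (by
      simp only [mul_sub, Finset.sum_sub_distrib, mul_ite, mul_one, mul_zero,
        Finset.sum_ite_eq', if_pos hi, mul_left_comm _ c, ← Finset.mul_sum, ← sq, hxN, hxc]
      ring)
    simp only [sub_smul, Finset.sum_sub_distrib, ite_smul, one_smul, zero_smul,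
      Finset.sum_ite_eq', if_pos hi, mul_smul, ← Finset.smul_sum, ← hPcal, sub_mulVec,
      smul_mulVec, hfix, mulVec_sub, mulVec_smul, mulVec_mulVec, hsq, one_mulVec,
      dotProduct_sub, dotProduct_smul, smul_eq_mul, hkey] at h
    have hc : (1 - c) * (1 + c) ≠ 0 := by
      apply ne_of_gt
      apply mul_pos <;> linarith
    refine (mul_eq_zero.mp ?_).resolve_left hc
    linear_combination h
  exact ⟨hkey, hzero, by rw [hkey, hzero, mul_zero]⟩
end

section
/- Identify ℝ^{16} with ℍ⁴ with real inner product ⟨x, y⟩ = Re(Σ_{s=1}^{4} x_s \overline{y_s}). Define real-linear maps E₁, E₂, E₃ on ℍ² by E₁(u₁,u₂) = (iu₁, −iu₂), E₂(u₁,u₂) = (ju₁, −ju₂), E₃(u₁,u₂) = (ku₁, −ku₂), and define P₀(u,v) = (u, −v), P₁(u,v) = (v, u), P₂(u,v) = (E₁v, −E₁u), P₃(u,v) = (E₂v, −E₂u), P₄(u,v) = (E₃v, −E₃u) for (u,v) ∈ ℍ²×ℍ². Then {P₀, …, P₄} is a symmetric Clifford system on ℝ^{16} with P₀P₁P₂P₃P₄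 ≠ Id and P₀P₁P₂P₃P₄ ≠ −Id; a unit vector x = (u₁, u₂; v₁, v₂) ∈ S^{15} lies in the focal submanifold M̃₊^{10} := {x ∈ S^{15} : ⟨P₀x, x⟩ = ⋯ = ⟨P₄x, x⟩ = 0} if and only if |u₁|² + |u₂|² = |v₁|² + |v₂|² = 1/2 and v₁\overline{u₁} + u₂\overline{v₂} = 0; and the map F(u₁, u₂; v₁, v₂) := (u₁, u₂; 2(\overline{u₂}v₁ − \overline{v₂}u₁)) is a bijection from M̃₊^{10} onto {(w₁, w₂; q) ∈ ℍ³ : |w₁|² + |w₂|² = 1/2, |q| = 1}, i.e. onto S⁷(1/√2) × S³(1). -/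
noncomputable section

/-- `ℝ^{16}` identified with `ℍ⁴ = ℍ² × ℍ²`. -/
abbrev QH4 : Type := (Quaternion ℝ × Quaternion ℝ) × (Quaternion ℝ × Quaternion ℝ)

/-- The real inner product `⟨x, y⟩ = Re (∑ x_s conj(y_s))` on `ℍ⁴`. -/
def qinner (x y : QH4) : ℝ :=
  (x.1.1 * star y.1.1 + x.1.2 * star y.1.2 + x.2.1 * star y.2.1 + x.2.2 * star y.2.2).re

/-- The imaginary quaternion units. -/
def qi : Quaternion ℝ := ⟨0, 1, 0, 0⟩
def qj : Quaternion ℝ := ⟨0, 0, 1, 0⟩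
def qk : Quaternion ℝ := ⟨0, 0, 0, 1⟩

/-- `E₁(u₁,u₂) = (i u₁, -i u₂)`. -/
def E₁' (u : Quaternion ℝ × Quaternion ℝ) : Quaternion ℝ × Quaternion ℝ :=
  (qi * u.1, -(qi * u.2))
/-- `E₂(u₁,u₂) = (j u₁, -j u₂)`. -/
def E₂' (u : Quaternion ℝ × Quaternion ℝ) : Quaternion ℝ × Quaternion ℝ :=
  (qj * u.1, -(qj * u.2))
/-- `E₃(u₁,u₂) = (k u₁, -k u₂)`. -/
def E₃' (u : Quaternion ℝ × Quaternion ℝ) : Quaternion ℝ × Quaternion ℝ :=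
  (qk * u.1, -(qk * u.2))

/-- The inhomogeneous symmetric Clifford system `P₀, …, P₄` on `ℝ^{16}`. -/
def Pmap' : Fin 5 → QH4 → QH4 :=
  ![fun x => (x.1, -x.2),
    fun x => (x.2, x.1),
    fun x => (E₁' x.2, -E₁' x.1),
    fun x => (E₂' x.2, -E₂' x.1),
    fun x => (E₃' x.2, -E₃' x.1)]

/-- The focal submanifold `M̃₊^{10} ⊆ S^{15}`. -/
def MTildePlus : Set QH4 :=
  {x | qinner x x = 1 ∧ ∀ α : Fin 5, qinner (Pmap' α x) x = 0}

/-- The map `F(u₁,u₂;v₁,v₂) = (u₁, u₂; 2(conj(u₂)v₁ - conj(v₂)u₁))`. -/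
def Fmap (x : QH4) : (Quaternion ℝ × Quaternion ℝ) × Quaternion ℝ :=
  ((x.1.1, x.1.2), (2 : Quaternion ℝ) * (star x.1.2 * x.2.1 - star x.2.2 * x.1.1))

@[simp] lemma qi_re : qi.re = 0 := rfl
@[simp] lemma qi_imI : qi.imI = 1 := rfl
@[simp] lemma qi_imJ : qi.imJ = 0 := rfl
@[simp] lemma qi_imK : qi.imK = 0 := rfl

@[simp] lemma qj_re : qj.re = 0 := rfl
@[simp] lemma qj_imI : qj.imI = 0 := rfl
@[simp] lemma qj_imJ : qj.imJ = 1 := rfl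
@[simp] lemma qj_imK : qj.imK = 0 := rfl

@[simp] lemma qk_re : qk.re = 0 := rfl
@[simp] lemma qk_imI : qk.imI = 0 := rfl
@[simp] lemma qk_imJ : qk.imJ = 0 := rfl
@[simp] lemma qk_imK : qk.imK = 1 := rfl

lemma qi_mul_qi_mul (a : Quaternion ℝ) : qi * (qi * a) = -a := by
  ext <;> simp

lemma qi_mul_qj_mul (a : Quaternion ℝ) : qi * (qj * a) = qk * a := by
  ext <;> simp

lemma qi_mul_qk_mul (a : Quaternion ℝ) : qi * (qk * a) = -(qj * a) := by
  ext <;> simp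

lemma qj_mul_qi_mul (a : Quaternion ℝ) : qj * (qi * a) = -(qk * a) := by
  ext <;> simp

lemma qj_mul_qj_mul (a : Quaternion ℝ) : qj * (qj * a) = -a := by
  ext <;> simp

lemma qj_mul_qk_mul (a : Quaternion ℝ) : qj * (qk * a) = qi * a := by
  ext <;> simp

lemma qk_mul_qi_mul (a : Quaternion ℝ) : qk * (qi * a) = qj * a := by
  ext <;> simp

lemma qk_mul_qj_mul (a : Quaternion ℝ) : qk * (qj * a) = -(qi * a) := by
  ext <;> simp

lemma qk_mul_qk_mul (a : Quaternion ℝ) : qk * (qk * a) = -a := by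
  ext <;> simp

lemma qinner_eq (x y : QH4) : qinner x y =
    (x.1.1 * star y.1.1).re + (x.1.2 * star y.1.2).re +
      (x.2.1 * star y.2.1).re + (x.2.2 * star y.2.2).re := by
  simp [qinner]

lemma qinner_self (x : QH4) : qinner x x =
    Quaternion.normSq x.1.1 + Quaternion.normSq x.1.2 +
      (Quaternion.normSq x.2.1 + Quaternion.normSq x.2.2) := by
  simp only [qinner_eq, Quaternion.self_mul_star, Quaternion.re_coe]
  ring

lemma qinner_Pmap'_comm (α : Fin 5) (x y : QH4) :
    qinner (Pmap' α x) y = qinner x (Pmap' α y) := by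
  fin_cases α <;> simp [Pmap', qinner_eq, E₁', E₂', E₃'] <;> ring

lemma Pmap'_anticomm (α β : Fin 5) (x : QH4) :
    Pmap' α (Pmap' β x) + Pmap' β (Pmap' α x) = if α = β then (2 : ℝ) • x else 0 := by
  fin_cases α <;> fin_cases β <;> refine Prod.ext (Prod.ext ?_ ?_) (Prod.ext ?_ ?_) <;>
    simp [Pmap', E₁', E₂', E₃', two_smul, qi_mul_qi_mul, qi_mul_qj_mul, qi_mul_qk_mul,
      qj_mul_qi_mul, qj_mul_qj_mul, qj_mul_qk_mul, qk_mul_qi_mul, qk_mul_qj_mul, qk_mul_qk_mul]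

lemma Pmap'_prod (x : QH4) :
    Pmap' 0 (Pmap' 1 (Pmap' 2 (Pmap' 3 (Pmap' 4 x)))) = ((-x.1.1, x.1.2), (-x.2.1, x.2.2)) := by
  have h0 (y : QH4) : Pmap' 0 y = (y.1, -y.2) := rfl
  have h1 (y : QH4) : Pmap' 1 y = (y.2, y.1) := rfl
  have h2 (y : QH4) : Pmap' 2 y = (E₁' y.2, -E₁' y.1) := rfl
  have h3 (y : QH4) : Pmap' 3 y = (E₂' y.2, -E₂' y.1) := rfl
  have h4 (y : QH4) : Pmap' 4 y = (E₃' y.2, -E₃' y.1) := rfl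
  simp [h0, h1, h2, h3, h4, E₁', E₂', E₃', qj_mul_qk_mul, qi_mul_qi_mul]

lemma mem_MTildePlus_iff {x : QH4} (hx : qinner x x = 1) :
    x ∈ MTildePlus ↔
      (Quaternion.normSq x.1.1 + Quaternion.normSq x.1.2 = 1 / 2 ∧
       Quaternion.normSq x.2.1 + Quaternion.normSq x.2.2 = 1 / 2 ∧
       x.2.1 * star x.1.1 + x.1.2 * star x.2.2 = 0) := by
  have h0 : qinner (Pmap' 0 x) x = Quaternion.normSq x.1.1 + Quaternion.normSq x.1.2 -
      (Quaternion.normSq x.2.1 + Quaternion.normSq x.2.2) := by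
    simp [Pmap', qinner_eq, Quaternion.normSq_def']
    ring
  have h1 : qinner (Pmap' 1 x) x = 2 * (x.2.1 * star x.1.1 + x.1.2 * star x.2.2).re := by
    simp [Pmap', qinner_eq]
    ring
  have h2 : qinner (Pmap' 2 x) x = -2 * (x.2.1 * star x.1.1 + x.1.2 * star x.2.2).imI := by
    simp [Pmap', qinner_eq, E₁']
    ring
  have h3 : qinner (Pmap' 3 x) x = -2 * (x.2.1 * star x.1.1 + x.1.2 * star x.2.2).imJ := by
    simp [Pmap', qinner_eq, E₂']
    ring
  have h4 : qinner (Pmap' 4 x) x = -2 * (x.2.1 * star x.1.1 + x.1.2 * star x.2.2).imK := by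
    simp [Pmap', qinner_eq, E₃']
    ring
  have hs := qinner_self x
  have hmem : x ∈ MTildePlus ↔ ∀ α : Fin 5, qinner (Pmap' α x) x = 0 := by
    simp [MTildePlus, hx]
  rw [hmem]
  constructor
  · intro h
    have e0 := h 0
    have e1 := h 1
    have e2 := h 2
    have e3 := h 3
    have e4 := h 4
    rw [h0] at e0
    rw [h1] at e1
    rw [h2] at e2
    rw [h3] at e3
    rw [h4] at e4
    refine ⟨by linarith, by linarith, Quaternion.ext _ _ ?_ ?_ ?_ ?_⟩
    exacts [(mul_eq_zero_iff_left two_ne_zero).mp e1, (mul_eq_zero_iff_left (by norm_num)).mp e2,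
      (mul_eq_zero_iff_left (by norm_num)).mp e3, (mul_eq_zero_iff_left (by norm_num)).mp e4]
  · rintro ⟨a, b, c⟩ α
    rw [c] at h1 h2 h3 h4
    fin_cases α
    · exact h0.trans (by linarith)
    · exact h1.trans (mul_zero _)
    · exact h2.trans (mul_zero _)
    · exact h3.trans (mul_zero _)
    · exact h4.trans (mul_zero _)

lemma mem_MTildePlus_iff' (x : QH4) :
    x ∈ MTildePlus ↔
      (Quaternion.normSq x.1.1 + Quaternion.normSq x.1.2 = 1 / 2 ∧
       Quaternion.normSq x.2.1 + Quaternion.normSq x.2.2 = 1 / 2 ∧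
       x.2.1 * star x.1.1 + x.1.2 * star x.2.2 = 0) := by
  refine ⟨fun h => (mem_MTildePlus_iff h.1).mp h, fun h => (mem_MTildePlus_iff ?_).mpr h⟩
  rw [qinner_self, h.1, h.2.1]
  norm_num

lemma two_mul_coe_normSq_add {a b : Quaternion ℝ}
    (h : Quaternion.normSq a + Quaternion.normSq b = 1 / 2) :
    (2 : Quaternion ℝ) * (Quaternion.normSq a + Quaternion.normSq b) = 1 := by
  have h2 : (2 : Quaternion ℝ) = ((2 : ℝ) : Quaternion ℝ) := by norm_cast
  rw [← Quaternion.coe_add, h, h2, ← Quaternion.coe_mul]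
  norm_num

/-- On `M̃₊`, the coordinates `v` are recovered from `u` and `q` by `v = (u₂ q, -u₁ conj(q))`. -/
lemma snd_eq_of_mem_MTildePlus {x : QH4} (hx : x ∈ MTildePlus) :
    x.2 = (x.1.2 * (Fmap x).2, -(x.1.1 * star (Fmap x).2)) := by
  obtain ⟨⟨u₁, u₂⟩, v₁, v₂⟩ := x
  obtain ⟨hu, -, h⟩ := (mem_MTildePlus_iff' _).mp hx
  simp only [Fmap] at hu h ⊢
  have hn : (2 : Quaternion ℝ) * (Quaternion.normSq u₁ + Quaternion.normSq u₂) = 1 :=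
       two_mul_coe_normSq_add hu
  have h' : u₁ * star v₁ + v₂ * star u₂ = 0 := by simpa using congrArg star h
  have e : v₁ * star u₁ = -(u₂ * star v₂) := eq_neg_of_add_eq_zero_left h
  have e' : u₁ * star v₁ = -(v₂ * star u₂) := eq_neg_of_add_eq_zero_left h'
  refine Prod.ext ?_ ?_
  · change v₁ = _
    calc v₁ = (2 * (Quaternion.normSq u₁ + Quaternion.normSq u₂)) * v₁ := by rw [hn, one_mul]
      _ = 2 * (v₁ * ((Quaternion.normSq u₁ : ℝ) : Quaternion ℝ) + Quaternion.normSq u₂ * v₁) := by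
        rw [← Quaternion.coe_commutes, mul_assoc, add_mul]
      _ = 2 * (v₁ * star u₁ * u₁ + u₂ * star u₂ * v₁) := by
        rw [mul_assoc v₁, Quaternion.star_mul_self, Quaternion.self_mul_star]
      _ = _ := by rw [e]; noncomm_ring
  · change v₂ = _
    calc v₂ = (2 * (Quaternion.normSq u₁ + Quaternion.normSq u₂)) * v₂ := by rw [hn, one_mul]
      _ = 2 * (v₂ * ((Quaternion.normSq u₂ : ℝ) : Quaternion ℝ) + Quaternion.normSq u₁ * v₂) := by
        rw [← Quaternion.coe_commutes, mul_assoc, add_mul, add_comm]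
      _ = 2 * (v₂ * star u₂ * u₂ + u₁ * star u₁ * v₂) := by
        rw [mul_assoc v₂, Quaternion.star_mul_self, Quaternion.self_mul_star]
      _ = _ := by
        rw [← neg_eq_iff_eq_neg.mpr e']
        simp only [star_mul, star_sub, star_star, star_ofNat]
        noncomm_ring

lemma bijOn_Fmap : Set.BijOn Fmap MTildePlus
    {p : (Quaternion ℝ × Quaternion ℝ) × Quaternion ℝ |
      Quaternion.normSq p.1.1 + Quaternion.normSq p.1.2 = 1 / 2 ∧
      Quaternion.normSq p.2 = 1} := by
  refine ⟨fun x hx => ?_, fun x hx y hy hxy => ?_, ?_⟩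
  · obtain ⟨hu, hv, -⟩ := (mem_MTildePlus_iff' x).mp hx
    refine ⟨hu, ?_⟩
    rw [snd_eq_of_mem_MTildePlus hx] at hv
    simp only [map_mul, Quaternion.normSq_neg, Quaternion.normSq_star] at hv
    linear_combination 2 * hv - 2 * Quaternion.normSq (Fmap x).2 * hu
  · have hu : x.1 = y.1 := congrArg (fun p => p.1) hxy
    refine Prod.ext hu ?_
    rw [snd_eq_of_mem_MTildePlus hx, snd_eq_of_mem_MTildePlus hy, hxy, hu]
  · rintro ⟨⟨w₁, w₂⟩, q⟩ ⟨hw, hq⟩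
    simp only at hw hq
    refine ⟨((w₁, w₂), (w₂ * q, -(w₁ * star q))), (mem_MTildePlus_iff' _).mpr ⟨hw, ?_, ?_⟩, ?_⟩
    · simp only [map_mul, Quaternion.normSq_neg, Quaternion.normSq_star, hq]
      linarith
    · simp only [star_neg, star_mul, star_star]
      noncomm_ring
    · have hn : (2 : Quaternion ℝ) * (Quaternion.normSq w₁ + Quaternion.normSq w₂) = 1 :=
       two_mul_coe_normSq_add hw
      refine Prod.ext rfl ?_
      simp only [Fmap, star_neg, star_mul, star_star]
      calc (2 : Quaternion ℝ) * (star w₂ * (w₂ * q) - -(q * star w₁) * w₁)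
          = 2 * (star w₂ * w₂ * q + q * (star w₁ * w₁)) := by noncomm_ring
        _ = (2 * (Quaternion.normSq w₁ + Quaternion.normSq w₂)) * q := by
          rw [Quaternion.star_mul_self, Quaternion.star_mul_self, ← Quaternion.coe_commutes]
          noncomm_ring
        _ = q := by rw [hn, one_mul]

/-- `{P₀, …, P₄}` above is a symmetric Clifford system on `ℝ^{16}` with
`P₀P₁P₂P₃P₄ ≠ ± Id`; a unit vector `x = (u₁,u₂;v₁,v₂)` lies in `M̃₊^{10}` iff
`|u₁|² + |u₂|² = |v₁|² + |v₂|² = 1/2` and `v₁ conj(u₁) + u₂ conj(v₂) = 0`; and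
`F` is a bijection from `M̃₊^{10}` onto `S⁷(1/√2) × S³(1)`. -/
theorem stmt_19 :
    (∀ α : Fin 5, ∀ x y : QH4, qinner (Pmap' α x) y = qinner x (Pmap' α y)) ∧
    (∀ α β : Fin 5, ∀ x : QH4,
      Pmap' α (Pmap' β x) + Pmap' β (Pmap' α x) = if α = β then (2 : ℝ) • x else 0) ∧
    (fun x => Pmap' 0 (Pmap' 1 (Pmap' 2 (Pmap' 3 (Pmap' 4 x))))) ≠ (fun x : QH4 => x) ∧
    (fun x => Pmap' 0 (Pmap' 1 (Pmap' 2 (Pmap' 3 (Pmap' 4 x))))) ≠ (fun x : QH4 => -x) ∧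
    (∀ x : QH4, qinner x x = 1 →
      (x ∈ MTildePlus ↔
        (Quaternion.normSq x.1.1 + Quaternion.normSq x.1.2 = 1 / 2 ∧
         Quaternion.normSq x.2.1 + Quaternion.normSq x.2.2 = 1 / 2 ∧
         x.2.1 * star x.1.1 + x.1.2 * star x.2.2 = 0))) ∧
    Set.BijOn Fmap MTildePlus
      {p : (Quaternion ℝ × Quaternion ℝ) × Quaternion ℝ |
        Quaternion.normSq p.1.1 + Quaternion.normSq p.1.2 = 1 / 2 ∧
        Quaternion.normSq p.2 = 1} := by
  refine ⟨qinner_Pmap'_comm, Pmap'_anticomm, fun h => ?_, fun h => ?_,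
    fun x hx => mem_MTildePlus_iff hx, bijOn_Fmap⟩
  · have h1 := congrArg (fun y : QH4 => y.1.1.re) (congrFun h ((1, 0), (0, 0)))
    simp only [Pmap'_prod, Quaternion.re_neg, Quaternion.re_one] at h1
    norm_num at h1
  · have h1 := congrArg (fun y : QH4 => y.1.2.re) (congrFun h ((0, 1), (0, 0)))
    simp only [Pmap'_prod, Prod.fst_neg, Prod.snd_neg, Quaternion.re_neg, Quaternion.re_one] at h1
    norm_num at h1
end
end
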